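/- Let a ∈ A and q ∈ ℍ with ‖a‖ < |q|. Then Q_q(a) is invertible in A and ‖Q_q(a)⁻¹‖ ≤ 1/(|q| − ‖a‖)². In particular σ_S(a) ⊆ {q ∈ ℍ : |q| ≤ ‖a‖}. -/

import Mathlib

noncomputable section

/-- `Q_q(a) = a² − 2 (Re q) • a + |q|² • 1`. -/
def Qop {A : Type*} [NormedRing A] [NormedAlgebra ℝ A] (a : A) (q : Quaternion ℝ) : A :=
  a ^ 2 - (2 * q.re) • a + (‖q‖ ^ 2) • (1 : A)

/-- The S-spectrum `σ_S(a)`. -/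
def sSpectrum {A : Type*} [NormedRing A] [NormedAlgebra ℝ A] (a : A) : Set (Quaternion ℝ) :=
  {q | ¬ IsUnit (Qop a q)}

/-- The ε-pseudo S-spectrum `Λ_ε^S(a)`. -/
def pseudoSSpectrum {A : Type*} [NormedRing A] [NormedAlgebra ℝ A] (ε : ℝ) (a : A) :
    Set (Quaternion ℝ) :=
  sSpectrum a ∪ {q | IsUnit (Qop a q) ∧ 1 / ε ≤ ‖Ring.inverse (Qop a q)‖}

open Polynomial Polynomial.Chebyshev in
/-- On `[-1, 1]`, the Chebyshev polynomial `U_n` is bounded by its value `n + 1` at `1`. -/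
theorem abs_eval_U_real_le (n : ℕ) {t : ℝ} (ht : |t| ≤ 1) : |(U ℝ n).eval t| ≤ n + 1 := by
  induction n with
  | zero => simp
  | succ n ih =>
    have hT := abs_eval_T_real_le_one (n + 1) ht
    push_cast
    rw [U_eq_X_mul_U_add_T, eval_add, eval_mul, eval_X]
    calc |t * (U ℝ n).eval t + (T ℝ (n + 1)).eval t|
        ≤ |t| * |(U ℝ n).eval t| + |(T ℝ (n + 1)).eval t| := by
          rw [← abs_mul]
          exact abs_add_le _ _
      _ ≤ 1 * (n + 1) + 1 := by gcongr
      _ = n + 1 + 1 := by ring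

section ChebyshevSeries

variable {A : Type*} [NormedRing A] [NormedAlgebra ℝ A]

open Polynomial.Chebyshev in
/-- The generating function of the Chebyshev polynomials of the second kind, evaluated at an
element of norm less than one: it inverts `s² - 2 t s + 1`. -/
theorem exists_inverse_sq_sub_add_one [CompleteSpace A] [NormOneClass A] {s : A} (hs : ‖s‖ < 1)
    {t : ℝ} (ht : |t| ≤ 1) :
    ∃ b : A, (s ^ 2 - (2 * t) • s + 1) * b = 1 ∧ b * (s ^ 2 - (2 * t) • s + 1) = 1 ∧
      ‖b‖ ≤ 1 / (1 - ‖s‖) ^ 2 := by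
  set f : ℕ → A := fun n ↦ (U ℝ n).eval t • s ^ n with hf
  have hg : HasSum (fun n : ℕ ↦ ((n : ℝ) + 1) * ‖s‖ ^ n) (1 / (1 - ‖s‖) ^ 2) := by
    simpa using hasSum_choose_mul_geometric_of_norm_lt_one (𝕜 := ℝ) 1 (r := ‖s‖) (by simpa using hs)
  have hfg (n : ℕ) : ‖f n‖ ≤ ((n : ℝ) + 1) * ‖s‖ ^ n := by
    rw [hf, norm_smul, Real.norm_eq_abs]
    exact mul_le_mul (abs_eval_U_real_le n ht) (norm_pow_le s n) (norm_nonneg _) (by positivity)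
  have hb : HasSum f (∑' n, f n) := (hg.summable.of_norm_bounded hfg).hasSum
  have hrec (n : ℕ) : f (n + 2) = (2 * t) • (s * f (n + 1)) - s ^ 2 * f n := by
    simp only [hf, mul_smul_comm, smul_smul, ← pow_succ', ← pow_add]
    push_cast
    rw [U_add_two, add_comm 2 n]
    simp [sub_smul]
  have h1 := (hasSum_nat_add_iff' 1).2 hb
  have h2 := (hasSum_nat_add_iff' 2).2 hb
  have h3 := ((h1.mul_left s).const_smul (2 * t)).sub (hb.mul_left (s ^ 2))
  simp_rw [← hrec] at h3
  have key := h2.unique h3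
  simp only [Finset.sum_range_succ, Finset.sum_range_zero, hf, zero_add] at key
  have hmul : (s ^ 2 - (2 * t) • s + 1) * ∑' n, f n = 1 := by
    simp only [hf, Nat.cast_zero, Nat.cast_one, U_zero, U_one, Polynomial.eval_one, pow_zero,
      pow_one, one_smul, Polynomial.eval_mul, Polynomial.eval_X, Polynomial.eval_ofNat, mul_sub,
      mul_one, smul_sub] at key ⊢
    rw [add_mul, sub_mul, smul_mul_assoc, one_mul, ← sub_eq_zero]
    rw [← sub_eq_zero] at key
    rw [← key]
    abel
  have hcomm : Commute (s ^ 2 - (2 * t) • s + 1) (∑' n, f n) := by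
    refine Commute.tsum_right _ fun n ↦ Commute.smul_right ?_ _
    exact ((((Commute.refl s).pow_left 2).sub_left ((Commute.refl s).smul_left _)).add_left
      (Commute.one_left s)).pow_right n
  exact ⟨_, hmul, hcomm.eq ▸ hmul, tsum_of_norm_bounded hg hfg⟩

theorem isUnit_Qop_and_norm_inverse_le [CompleteSpace A] [NormOneClass A] {a : A}
    {q : Quaternion ℝ} (h : ‖a‖ < ‖q‖) :
    IsUnit (Qop a q) ∧ ‖Ring.inverse (Qop a q)‖ ≤ 1 / (‖q‖ - ‖a‖) ^ 2 := by
  have hq : 0 < ‖q‖ := (norm_nonneg a).trans_lt h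
  have hre : |q.re| ≤ ‖q‖ := by
    refine abs_le_of_sq_le_sq ?_ hq.le
    rw [sq ‖q‖, ← Quaternion.normSq_eq_norm_mul_self, Quaternion.normSq_def']
    nlinarith [sq_nonneg q.imI, sq_nonneg q.imJ, sq_nonneg q.imK]
  have hnorm : ‖‖q‖⁻¹ • a‖ = ‖a‖ / ‖q‖ := by
    rw [norm_smul, norm_inv, norm_norm, inv_mul_eq_div]
  obtain ⟨b, hb, hb', hbn⟩ := exists_inverse_sq_sub_add_one (s := ‖q‖⁻¹ • a) (t := q.re / ‖q‖)
    (by rwa [hnorm, div_lt_one hq]) (by rwa [abs_div, abs_norm, div_le_one hq])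
  have hQ : Qop a q =
      ‖q‖ ^ 2 • ((‖q‖⁻¹ • a) ^ 2 - (2 * (q.re / ‖q‖)) • (‖q‖⁻¹ • a) + 1) := by
    rw [Qop, smul_add, smul_sub, smul_pow, smul_smul, smul_smul, smul_smul]
    congr 2
    · rw [← mul_pow, mul_inv_cancel₀ hq.ne', one_pow, one_smul]
    · congr 1
      field_simp
  let u : Aˣ := ⟨Qop a q, (‖q‖ ^ 2)⁻¹ • b,
    by rw [hQ, smul_mul_smul_comm, hb, mul_inv_cancel₀ (by positivity), one_smul],
    by rw [hQ, smul_mul_smul_comm, hb', inv_mul_cancel₀ (by positivity), one_smul]⟩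
  refine ⟨u.isUnit, ?_⟩
  calc ‖Ring.inverse (Qop a q)‖ = (‖q‖ ^ 2)⁻¹ * ‖b‖ := by
        rw [show Ring.inverse (Qop a q) = (‖q‖ ^ 2)⁻¹ • b from Ring.inverse_unit u, norm_smul,
          norm_inv, norm_pow, norm_norm]
    _ ≤ (‖q‖ ^ 2)⁻¹ * (1 / (1 - ‖a‖ / ‖q‖) ^ 2) := by
        rw [hnorm] at hbn
        gcongr
    _ = 1 / (‖q‖ - ‖a‖) ^ 2 := by
        rw [one_sub_div hq.ne']
        have : ‖q‖ - ‖a‖ ≠ 0 := (sub_pos.2 h).ne'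
        field_simp

end ChebyshevSeries

theorem isUnit_Qop_of_norm_lt
    {A : Type*} [NormedRing A] [NormedAlgebra ℝ A] [CompleteSpace A] [NormOneClass A]
    (a : A) (q : Quaternion ℝ) (h : ‖a‖ < ‖q‖) :
    IsUnit (Qop a q) ∧ ‖Ring.inverse (Qop a q)‖ ≤ 1 / (‖q‖ - ‖a‖) ^ 2 ∧
    sSpectrum a ⊆ {p : Quaternion ℝ | ‖p‖ ≤ ‖a‖} := by
  obtain ⟨hu, hn⟩ := isUnit_Qop_and_norm_inverse_le h
  refine ⟨hu, hn, fun p hp ↦ ?_⟩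
  by_contra hlt
  exact hp (isUnit_Qop_and_norm_inverse_le (not_le.1 hlt)).1
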